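/- Let a and b be real numbers with a > 0 and b > max{a, 2−a}, and let n be a positive integer. Then Σ over positive integers d of d^{−(b−a+2)} · Σ over pairs (e₁, e₂) with 1 ≤ e₁, e₂ ≤ d and e₁e₂ ≡ n (mod d) of ζ(1−a, e₁/d) converges absolutely and equals [ζ(1−a)·ζ(b+1)/ζ(b−a+2)] · σ_{b−a+1}(n) / n^{b−a+1}. -/

import Mathlib

open Finset

/-- `σ_c(n) = ∑_{d ∣ n} d^c` for real `c`. -/
noncomputable def sigmaR (c : ℝ) (n : ℕ) : ℝ := ∑ d ∈ n.divisors, (d : ℝ) ^ c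

/-- The Hurwitz zeta function `ζ(s, x)` for `x ∈ (0, 1]` (analytic continuation of
`∑_{n ≥ 0} (n + x)^{-s}`); note that `ζ(s, 1) = ζ(s)`. -/
noncomputable def hzeta (s : ℂ) (x : ℝ) : ℂ := HurwitzZeta.hurwitzZeta (x : UnitAddCircle) s


theorem aux_count (d e n : ℕ) (hd : 0 < d) :
    ((Finset.Icc 1 d).filter (fun x => e * x ≡ n [MOD d])).card
      = if Nat.gcd e d ∣ n then Nat.gcd e d else 0 := by
  have hg : 0 < Nat.gcd e d := Nat.gcd_pos_of_pos_right _ hd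
  obtain ⟨f, m, hco, he, hdm⟩ := Nat.exists_coprime e d
  set g := Nat.gcd e d with hgdef
  split_ifs with h
  · obtain ⟨n', rfl⟩ := h
    have hm : 0 < m := by
      rcases Nat.eq_zero_or_pos m with h0 | h0
      · simp [h0] at hdm; omega
      · exact h0
    obtain ⟨k, hk1, hk2⟩ := Nat.chineseRemainder hco 0 n'
    obtain ⟨v, rfl⟩ := (Nat.modEq_zero_iff_dvd.mp hk1)
    have key : (Finset.Icc 1 d).filter (fun x => e * x ≡ g * n' [MOD d])
        = (Finset.Ioc 0 d).filter (fun x => x ≡ v [MOD m]) := by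
      ext x
      simp only [Finset.mem_filter, Finset.mem_Icc, Finset.mem_Ioc, Nat.succ_le_iff]
      refine and_congr_right fun _ => ?_
      have e1 : e * x = g * (f * x) := by rw [he]; ring
      have e2 : d = g * m := by rw [hdm]; ring
      rw [e1, e2]
      constructor
      · intro hx
        have hx := Nat.ModEq.mul_left_cancel' hg.ne' hx
        exact Nat.ModEq.cancel_left_of_coprime (Nat.coprime_comm.mp hco) (hx.trans hk2.symm)
      · intro hx
        exact Nat.ModEq.mul_left' g ((hx.mul_left f).trans hk2)
    rw [key]
    have := Nat.Ioc_filter_modEq_card 0 d hm v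
    have hmq : (m : ℚ) ≠ 0 := by exact_mod_cast hm.ne'
    have hq : ((d : ℚ) - v) / m = (0 - v) / m + (g : ℤ) := by
      have : (d : ℚ) = m * g := by exact_mod_cast (by rw [hdm])
      rw [this]; push_cast; field_simp; ring
    push_cast at this
    rw [hq, Int.floor_add_intCast, add_sub_cancel_left, max_eq_left (by positivity)] at this
    exact_mod_cast this
  · rw [Finset.card_eq_zero, Finset.filter_eq_empty_iff]
    intro x _ hx
    apply h
    have h1 := hx.of_dvd (Nat.gcd_dvd_right e d)
    have h2 : e * x ≡ 0 [MOD g] :=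
      Nat.modEq_zero_iff_dvd.mpr ((Nat.gcd_dvd_left e d).mul_right x)
    exact Nat.modEq_zero_iff_dvd.mp (h1.symm.trans h2)

theorem aux_gcd_sum (d : ℕ) (hd : 0 < d) (h : ℕ → ℂ) (x : ℝ → ℂ) :
    ∑ e ∈ Finset.Icc 1 d, h (Nat.gcd e d) * x ((e : ℝ) / d)
      = ∑ p ∈ d.divisorsAntidiagonal, h p.1 *
          ∑ f ∈ (Finset.Icc 1 p.2).filter (fun f => Nat.Coprime f p.2), x ((f : ℝ) / p.2) := by
  simp_rw [Finset.mul_sum]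
  rw [Finset.sum_sigma']
  refine Finset.sum_bij' (fun e _ => ⟨(Nat.gcd e d, d / Nat.gcd e d), e / Nat.gcd e d⟩)
    (fun q _ => q.1.1 * q.2) ?_ ?_ ?_ ?_ ?_
  · intro e he
    have hg : 0 < Nat.gcd e d := Nat.gcd_pos_of_pos_right _ hd
    simp only [Finset.mem_Icc] at he
    simp only [Finset.mem_sigma, Nat.mem_divisorsAntidiagonal, Finset.mem_filter, Finset.mem_Icc]
    refine ⟨⟨Nat.mul_div_cancel' (Nat.gcd_dvd_right e d), hd.ne'⟩, ⟨?_, ?_⟩, ?_⟩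
    · exact Nat.div_pos (Nat.gcd_le_left _ he.1) hg
    · exact Nat.div_le_div_right he.2
    · exact Nat.coprime_div_gcd_div_gcd hg
  · rintro ⟨⟨g, m⟩, f⟩ hq
    simp only [Finset.mem_sigma, Nat.mem_divisorsAntidiagonal, Finset.mem_filter,
      Finset.mem_Icc] at hq ⊢
    obtain ⟨⟨rfl, h0⟩, ⟨h1, h2⟩, h3⟩ := hq
    exact ⟨Nat.mul_pos (Nat.pos_of_mul_pos_right hd) h1, Nat.mul_le_mul_left g h2⟩
  · intro e he
    exact Nat.mul_div_cancel' (Nat.gcd_dvd_left e d)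
  · rintro ⟨⟨g, m⟩, f⟩ hq
    simp only [Finset.mem_sigma, Nat.mem_divisorsAntidiagonal, Finset.mem_filter,
      Finset.mem_Icc] at hq ⊢
    obtain ⟨⟨rfl, h0⟩, ⟨h1, h2⟩, h3⟩ := hq
    have hg : 0 < g := Nat.pos_of_ne_zero (by rintro rfl; simp at h0)
    have : Nat.gcd (g * f) (g * m) = g := by
      rw [Nat.gcd_mul_left, h3.gcd_eq_one, mul_one]
    simp [this, hg]
  · intro e he
    have hg : 0 < Nat.gcd e d := Nat.gcd_pos_of_pos_right _ hd
    have hg' : ((Nat.gcd e d : ℕ) : ℝ) ≠ 0 := by exact_mod_cast hg.ne'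
    congr 2
    simp only
    rw [Nat.cast_div (Nat.gcd_dvd_left e d) hg', Nat.cast_div (Nat.gcd_dvd_right e d) hg',
      div_div_div_cancel_right₀ hg']

theorem aux_distrib (d : ℕ) (hd : 0 < d) (s : ℂ) (hs : s ≠ 1) :
    ∑ e ∈ Finset.Icc 1 d, hzeta s ((e : ℝ) / d) = riemannZeta s * (d : ℂ) ^ s := by
  have : NeZero d := ⟨hd.ne'⟩
  have h := ZMod.LFunction_stdAddChar_eq_expZeta (N := d) 0 s (Or.inr hs)
  rw [map_zero, HurwitzZeta.expZeta_zero] at h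
  simp only [ZMod.LFunction, zero_mul, AddChar.map_zero_eq_one, one_mul] at h
  have hdc : (d : ℂ) ≠ 0 := by exact_mod_cast hd.ne'
  have h2 : ∑ e ∈ Finset.Icc 1 d, hzeta s ((e : ℝ) / d)
      = ∑ j : ZMod d, HurwitzZeta.hurwitzZeta (ZMod.toAddCircle j) s := by
    refine Finset.sum_bij (fun e _ => (e : ZMod d)) (fun _ _ => Finset.mem_univ _) ?_ ?_ ?_
    · intro a ha b hb hab
      simp only [Finset.mem_Icc] at ha hb
      rw [ZMod.natCast_eq_natCast_iff] at hab
      rcases Nat.lt_or_ge a d with h1 | h1 <;> rcases Nat.lt_or_ge b d with h2 | h2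
      · exact Nat.ModEq.eq_of_lt_of_lt hab h1 h2
      · have : b = d := by omega
        subst this
        have := hab.trans (Nat.modEq_zero_iff_dvd.mpr dvd_rfl)
        have := Nat.le_of_dvd (by omega) (Nat.modEq_zero_iff_dvd.mp this)
        omega
      · have : a = d := by omega
        subst this
        have := hab.symm.trans (Nat.modEq_zero_iff_dvd.mpr dvd_rfl)
        have := Nat.le_of_dvd (by omega) (Nat.modEq_zero_iff_dvd.mp this)
        omega
      · omega
    · intro j _
      by_cases hj : j = 0
      · exact ⟨d, by simp; omega, by simp [hj]⟩
      · refine ⟨j.val, ?_, by simp⟩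
        have := ZMod.val_lt j
        have h3 : j.val ≠ 0 := by simpa [ZMod.val_eq_zero] using hj
        simp only [Finset.mem_Icc]; omega
    · intro e _
      rw [ZMod.toAddCircle_natCast]; rfl
  rw [h2, ← h, Complex.cpow_neg]
  have : (d : ℂ) ^ s ≠ 0 := by simp [Complex.cpow_eq_zero_iff, hdc]
  field_simp

/-- The sum of Hurwitz zeta values over reduced fractions of denominator `m`. -/
noncomputable def auxG (s : ℂ) : ArithmeticFunction ℂ :=
  ⟨fun m => ∑ f ∈ (Finset.Icc 1 m).filter (fun f => Nat.Coprime f m), hzeta s ((f : ℝ) / m),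
    by simp⟩

/-- The scaled power function. -/
noncomputable def auxP (c s : ℂ) : ArithmeticFunction ℂ :=
  ⟨fun m => if m = 0 then 0 else c * (m : ℂ) ^ s, by simp⟩

/-- The function `g` on divisors `g` of `n`. -/
noncomputable def auxH (n : ℕ) : ArithmeticFunction ℂ :=
  ⟨fun g => if g ∈ n.divisors then (g : ℂ) else 0, by simp⟩

open scoped ArithmeticFunction.Moebius ArithmeticFunction.zeta in
theorem auxG_eq (s : ℂ) (hs : s ≠ 1) :
    auxG s = (μ : ArithmeticFunction ℂ) * auxP (riemannZeta s) s := by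
  have h : (ζ : ArithmeticFunction ℂ) * auxG s = auxP (riemannZeta s) s := by
    ext d
    rcases Nat.eq_zero_or_pos d with rfl | hd
    · simp
    · have h1 := aux_gcd_sum d hd (fun _ => 1) (hzeta s)
      simp only [one_mul] at h1
      rw [aux_distrib d hd s hs] at h1
      simp only [auxP, ArithmeticFunction.coe_mk, hd.ne', if_false]
      rw [h1, ArithmeticFunction.mul_apply]
      refine Finset.sum_congr rfl fun p hp => ?_
      have hp := Nat.mem_divisorsAntidiagonal.mp hp
      have : p.1 ≠ 0 := by rintro h0; simp [h0] at hp; omega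
      simp [this, auxG]
  rw [← h, ← mul_assoc, ArithmeticFunction.coe_moebius_mul_coe_zeta, one_mul]

theorem aux_inner (s : ℂ) (n d : ℕ) (hn : 0 < n) :
    ∑ e ∈ (Finset.Icc 1 d ×ˢ Finset.Icc 1 d).filter
              (fun e : ℕ × ℕ => e.1 * e.2 ≡ n [MOD d]), hzeta s ((e.1 : ℝ) / d)
      = (auxH n * auxG s) d := by
  rcases Nat.eq_zero_or_pos d with rfl | hd
  · simp
  rw [ArithmeticFunction.mul_apply]
  have := aux_gcd_sum d hd (auxH n) (hzeta s)
  simp only [auxG, ArithmeticFunction.coe_mk]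
  rw [← this, Finset.sum_filter, Finset.sum_product]
  refine Finset.sum_congr rfl fun e _ => ?_
  simp only
  rw [← Finset.sum_filter, Finset.sum_const, aux_count d e n hd, nsmul_eq_mul]
  simp [auxH, hn.ne']

theorem auxH_hasSum (n : ℕ) (w : ℂ) :
    LSeriesHasSum (auxH n) w (∑ g ∈ n.divisors, (g : ℂ) / (g : ℂ) ^ w) := by
  have e : ∑ g ∈ n.divisors, (g : ℂ) / (g : ℂ) ^ w
      = ∑ g ∈ n.divisors, LSeries.term (auxH n) w g := by
    refine Finset.sum_congr rfl fun g hg => ?_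
    rw [LSeries.term_of_ne_zero (Nat.pos_of_mem_divisors hg).ne']
    simp only [auxH, ArithmeticFunction.coe_mk, hg, if_true]
  · unfold LSeriesHasSum
    rw [e]
    refine hasSum_sum_of_ne_finset_zero ?_
    intro b hb
    rw [LSeries.term_def]
    simp only [auxH, ArithmeticFunction.coe_mk, hb, if_false, zero_div, ite_self]

theorem auxP_hasSum (c s w : ℂ) (h : 1 < (w - s).re) :
    LSeriesHasSum (auxP c s) w (c * riemannZeta (w - s)) := by
  have := (LSeriesHasSum_one h).mul_left c
  unfold LSeriesHasSum
  convert! this using 2 with m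
  rcases eq_or_ne m 0 with rfl | hm
  · simp
  · have hmc : (m : ℂ) ≠ 0 := by exact_mod_cast hm
    have h1 : (m : ℂ) ^ s ≠ 0 := by simp [Complex.cpow_eq_zero_iff, hmc]
    rw [LSeries.term_of_ne_zero hm, LSeries.term_of_ne_zero hm]
    simp only [auxP, ArithmeticFunction.coe_mk, hm, if_false, Pi.one_apply]
    rw [Complex.cpow_sub _ _ hmc]
    field_simp

open scoped ArithmeticFunction.Moebius in
theorem aux_mu_hasSum (w : ℂ) (hw : 1 < w.re) :
    LSeriesHasSum (μ : ArithmeticFunction ℂ) w (riemannZeta w)⁻¹ := by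
  have h1 := (ArithmeticFunction.LSeriesSummable_moebius_iff.mpr hw).LSeriesHasSum
  have h2 := LSeries_one_mul_Lseries_moebius hw
  rw [LSeries_one_eq_riemannZeta hw] at h2
  rw [eq_inv_of_mul_eq_one_right h2] at h1
  exact h1

theorem aux_main (s w : ℂ) (n : ℕ) (hs : s ≠ 1) (hw : 1 < w.re) (h : 1 < (w - s).re) :
    LSeriesHasSum (fun d => (auxH n * auxG s) d) w ((∑ g ∈ n.divisors, (g : ℂ) / (g : ℂ) ^ w) *
      ((riemannZeta w)⁻¹ * (riemannZeta s * riemannZeta (w - s)))) := by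
  rw [auxG_eq s hs]
  exact ArithmeticFunction.LSeriesHasSum_mul (auxH_hasSum n w)
    (ArithmeticFunction.LSeriesHasSum_mul (aux_mu_hasSum w hw) (auxP_hasSum _ s w h))

theorem aux_sigma (c : ℝ) (n : ℕ) (hn : 0 < n) :
    ∑ g ∈ n.divisors, (g : ℂ) / (g : ℂ) ^ ((c : ℂ) + 1)
      = (sigmaR c n : ℂ) / ((n : ℝ) ^ c : ℝ) := by
  rw [← Complex.ofReal_div]
  unfold sigmaR
  rw [← Nat.sum_div_divisors n (fun d => (d : ℝ) ^ c), Finset.sum_div, Complex.ofReal_sum]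
  refine Finset.sum_congr rfl fun g hg => ?_
  have hg0 := Nat.pos_of_mem_divisors hg
  have hgr : (0 : ℝ) < g := by exact_mod_cast hg0
  have hnr : (0 : ℝ) < n := by exact_mod_cast hn
  have e : ((g : ℂ)) ^ ((c : ℂ) + 1) = (((g : ℝ) ^ (c + 1) : ℝ) : ℂ) := by
    rw [Complex.ofReal_cpow hgr.le]; push_cast; rfl
  rw [e, Nat.cast_div (Nat.dvd_of_mem_divisors hg) hgr.ne', Real.div_rpow hnr.le hgr.le,
    Real.rpow_add hgr, Real.rpow_one, ← Complex.ofReal_natCast g, ← Complex.ofReal_div]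
  congr 1
  have := (Real.rpow_pos_of_pos hgr c).ne'
  have := (Real.rpow_pos_of_pos hnr c).ne'
  field_simp

theorem stmt9 (a b : ℝ) (ha : 0 < a) (hb : max a (2 - a) < b) (n : ℕ) (hn : 0 < n) :
    Summable (fun d : ℕ =>
      ‖((d : ℝ) ^ (-(b - a + 2)) : ℝ) *
          ∑ e ∈ (Finset.Icc 1 d ×ˢ Finset.Icc 1 d).filter
              (fun e : ℕ × ℕ => e.1 * e.2 ≡ n [MOD d]),
            hzeta (1 - (a : ℂ)) ((e.1 : ℝ) / d)‖) ∧
    (∑' d : ℕ,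
        ((d : ℝ) ^ (-(b - a + 2)) : ℝ) *
          ∑ e ∈ (Finset.Icc 1 d ×ˢ Finset.Icc 1 d).filter
              (fun e : ℕ × ℕ => e.1 * e.2 ≡ n [MOD d]),
            hzeta (1 - (a : ℂ)) ((e.1 : ℝ) / d))
      = riemannZeta (1 - (a : ℂ)) * riemannZeta ((b : ℂ) + 1) / riemannZeta ((b : ℂ) - a + 2)
          * (sigmaR (b - a + 1) n : ℂ) / ((n : ℝ) ^ (b - a + 1) : ℝ) := by
  have hab : a < b := (le_max_left _ _).trans_lt hb
  have hs : (1 - (a : ℂ)) ≠ 1 := by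
    intro h
    have : (a : ℂ) = 0 := by linear_combination -h
    exact ha.ne' (by exact_mod_cast this)
  have hw : 1 < ((b : ℂ) - a + 2).re := by
    simp; linarith
  have hws : 1 < (((b : ℂ) - a + 2) - (1 - (a : ℂ))).re := by
    simp; linarith
  have main := aux_main (1 - (a : ℂ)) ((b : ℂ) - a + 2) n hs hw hws
  have hfun : (fun d : ℕ => (((d : ℝ) ^ (-(b - a + 2)) : ℝ) : ℂ) *
          ∑ e ∈ (Finset.Icc 1 d ×ˢ Finset.Icc 1 d).filter
              (fun e : ℕ × ℕ => e.1 * e.2 ≡ n [MOD d]),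
            hzeta (1 - (a : ℂ)) ((e.1 : ℝ) / d))
      = LSeries.term (fun d => (auxH n * auxG (1 - (a : ℂ))) d) ((b : ℂ) - a + 2) := by
    funext d
    rw [aux_inner _ _ _ hn, LSeries.term_def₀ (by simp), mul_comm,
      Complex.ofReal_cpow (Nat.cast_nonneg d)]
    push_cast
    rfl
  unfold LSeriesHasSum at main
  rw [← hfun] at main
  refine ⟨main.summable.norm, ?_⟩
  rw [main.tsum_eq]
  have e1 : ((b : ℂ) - a + 2) - (1 - (a : ℂ)) = b + 1 := by ring
  have e2 := aux_sigma (b - a + 1) n hn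
  have e3 : (((b - a + 1 : ℝ) : ℂ) + 1) = (b : ℂ) - a + 2 := by push_cast; ring
  rw [e3] at e2
  rw [e1, e2]
  ring
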